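/- arXiv:1803.01626 — 10 statements merged into one kernel-verified Lean document; each statement's English description precedes it below -/
import Mathlib

section
/- Let X be a finite nonempty set, let P be a probability distribution on X, and let f : X → ℝ. Define φ_f(λ) = log(Σ_x P(x)·exp(λ·(f(x) − E_P[f]))) for λ ∈ ℝ, its dual φ_{⋆,f}(x) = sup_{λ∈ℝ} (λ·x − φ_f(λ)) (valued in [0,+∞]), and φ_{+,f}^{-1}(t) = inf { x ≥ 0 : φ_{⋆,f}(x) > t } (valued in [0,+∞]). Then for every probability distribution Q on X with Q ≪ P, one has E_Q[f] − E_P[f] ≤ φ_{+,f}^{-1}(KL(Q,P)). -/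
open Finset

section Defs
variable {X : Type*} [Fintype X]

/-- `P` is a probability distribution on the finite set `X`. -/
def IsDist (P : X → ℝ) : Prop := (∀ x, 0 ≤ P x) ∧ ∑ x, P x = 1

/-- `Q ≪ P`: absolute continuity. -/
def AbsCont (Q P : X → ℝ) : Prop := ∀ x, P x = 0 → Q x = 0

/-- Mean of `f` under `P`. -/
noncomputable def distMean (P f : X → ℝ) : ℝ := ∑ x, P x * f x

/-- Variance of `f` under `P`. -/
noncomputable def distVar (P f : X → ℝ) : ℝ := ∑ x, P x * (f x - distMean P f) ^ 2

/-- Kullback-Leibler divergence `KL(Q,P)`. -/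
noncomputable def distKL (Q P : X → ℝ) : ℝ :=
  ∑ x, if 0 < Q x then Q x * Real.log (Q x / P x) else 0

/-- The local variance `V_{P,Q}(f) = ∑_{x : P(x) ≥ Q(x)} P(x) (f(x) - E_P f)^2`. -/
noncomputable def Vloc (P Q f : X → ℝ) : ℝ :=
  ∑ x, if Q x ≤ P x then P x * (f x - distMean P f) ^ 2 else 0

/-- Span of `f`: `max f - min f`. -/
noncomputable def distSpan [Nonempty X] (f : X → ℝ) : ℝ :=
  univ.sup' univ_nonempty f - univ.inf' univ_nonempty f

end Defs

/-- Log moment generating function `φ_f(λ)` of `f(X) − E_P[f]` for `X ∼ P`. -/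
noncomputable def phiF {X : Type*} [Fintype X] (P f : X → ℝ) (l : ℝ) : ℝ :=
  Real.log (∑ x, P x * Real.exp (l * (f x - distMean P f)))

/-- Legendre dual `φ_{⋆,f}(x) = sup_{λ ∈ ℝ} (λ x − φ_f(λ))`, valued in the extended reals. -/
noncomputable def phiStar (phi : ℝ → ℝ) (x : ℝ) : EReal :=
  ⨆ l : ℝ, ((l * x - phi l : ℝ) : EReal)

/-- `φ_{+,f}^{-1}(t) = inf { x ≥ 0 : φ_{⋆,f}(x) > t }`, valued in `[0, +∞]`
(the infimum of the empty set being `+∞`). -/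
noncomputable def phiPlusInv (phi : ℝ → ℝ) (t : ℝ) : EReal :=
  sInf {y : EReal | ∃ x : ℝ, 0 ≤ x ∧ (t : EReal) < phiStar phi x ∧ y = (x : EReal)}

lemma IsDist.sum_mul_exp_pos {X : Type*} [Fintype X] {P : X → ℝ} (hP : IsDist P) (g : X → ℝ) :
    0 < ∑ x, P x * Real.exp (g x) := by
  refine Finset.sum_pos' (fun x _ => mul_nonneg (hP.1 x) (Real.exp_pos _).le) ?_
  by_contra! h
  have h0 : ∀ x, P x = 0 := fun x =>
    le_antisymm (nonpos_of_mul_nonpos_left (h x (mem_univ x)) (Real.exp_pos _)) (hP.1 x)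
  have := hP.2
  simp [h0] at this

/-- The Gibbs (Donsker–Varadhan) variational inequality. -/
lemma sum_mul_sub_log_sum_exp_le_distKL {X : Type*} [Fintype X] {P Q : X → ℝ}
    (hP : IsDist P) (hQ : IsDist Q) (hQP : AbsCont Q P) (g : X → ℝ) :
    ∑ x, Q x * g x - Real.log (∑ x, P x * Real.exp (g x)) ≤ distKL Q P := by
  have hZ := hP.sum_mul_exp_pos g
  set Z := ∑ x, P x * Real.exp (g x) with hZdef
  have key : ∀ x, Q x * g x - Q x * Real.log Z
      - (if 0 < Q x then Q x * Real.log (Q x / P x) else 0)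
      ≤ P x * Real.exp (g x) / Z - Q x := by
    intro x
    split_ifs with hx
    · have hPx : 0 < P x :=
        lt_of_le_of_ne (hP.1 x) fun h => hx.ne' (hQP x h.symm)
      have hlog := Real.log_le_sub_one_of_pos
        (show 0 < P x * Real.exp (g x) / (Q x * Z) by positivity)
      rw [Real.log_div (by positivity) (by positivity), Real.log_mul hPx.ne' (Real.exp_ne_zero _),
        Real.log_exp, Real.log_mul hx.ne' hZ.ne'] at hlog
      rw [Real.log_div hx.ne' hPx.ne']
      have hmul := mul_le_mul_of_nonneg_left hlog hx.le
      have heq : Q x * (P x * Real.exp (g x) / (Q x * Z) - 1)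
          = P x * Real.exp (g x) / Z - Q x := by
        field_simp
      linarith
    · have hx0 : Q x = 0 := le_antisymm (not_lt.mp hx) (hQ.1 x)
      have := mul_nonneg (hP.1 x) (Real.exp_pos (g x)).le
      simp only [hx0, zero_mul, sub_zero]
      positivity
  have hsum := Finset.sum_le_sum fun x (_ : x ∈ univ) => key x
  simp only [Finset.sum_sub_distrib, ← Finset.sum_mul, ← Finset.sum_div, hQ.2, ← hZdef,
    div_self hZ.ne'] at hsum
  unfold distKL
  linarith

lemma distKL_self {X : Type*} [Fintype X] (P : X → ℝ) : distKL P P = 0 := by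
  refine Finset.sum_eq_zero fun x _ => ?_
  split_ifs with h
  · simp [div_self h.ne']
  · rfl

lemma mul_distMean_sub_phiF_le_distKL {X : Type*} [Fintype X] {P Q : X → ℝ}
    (hP : IsDist P) (hQ : IsDist Q) (hQP : AbsCont Q P) (f : X → ℝ) (l : ℝ) :
    l * (distMean Q f - distMean P f) - phiF P f l ≤ distKL Q P := by
  have h := sum_mul_sub_log_sum_exp_le_distKL hP hQ hQP fun x => l * (f x - distMean P f)
  have heq : ∑ x, Q x * (l * (f x - distMean P f)) = l * (distMean Q f - distMean P f) := by
    simp only [mul_left_comm _ l, ← Finset.mul_sum, mul_sub, Finset.sum_sub_distrib,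
      ← Finset.sum_mul, hQ.2, one_mul, distMean]
  rwa [heq] at h

/-- Transportation lemma, upper part: for `Q ≪ P`,
`E_Q[f] − E_P[f] ≤ φ_{+,f}^{-1}(KL(Q,P))`. -/
theorem transportation_upper {X : Type*} [Fintype X] [Nonempty X]
    (P Q : X → ℝ) (hP : IsDist P) (hQ : IsDist Q) (hQP : AbsCont Q P) (f : X → ℝ) :
    ((distMean Q f - distMean P f : ℝ) : EReal) ≤ phiPlusInv (phiF P f) (distKL Q P) := by
  refine le_sInf ?_
  rintro _ ⟨x, hx, hlt, rfl⟩
  obtain ⟨l, hl⟩ := lt_iSup_iff.mp hlt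
  rw [EReal.coe_lt_coe_iff] at hl
  rw [EReal.coe_le_coe_iff]
  have hgibbs := mul_distMean_sub_phiF_le_distKL hP hQ hQP f l
  by_contra! hxlt
  rcases le_total 0 l with h0 | h0
  · linarith [mul_le_mul_of_nonneg_left hxlt.le h0]
  · have hphi := mul_distMean_sub_phiF_le_distKL hP hP (fun _ h => h) f l
    rw [distKL_self, sub_self, mul_zero] at hphi
    have hKL := mul_distMean_sub_phiF_le_distKL hP hQ hQP f 0
    have hphi0 : phiF P f 0 = 0 := by simp [phiF, hP.2]
    rw [hphi0, zero_mul, sub_zero] at hKL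
    linarith [mul_nonpos_of_nonpos_of_nonneg h0 hx]
end

section
/- Let X be a finite nonempty set, let P and Q be probability distributions on X with Q ≪ P, and let f : X → ℝ. Then E_Q[f] − E_P[f] ≤ √(2·V_P(f)·KL(Q,P)) + (2/3)·span(f)·KL(Q,P). -/
open Finset

theorem Real.exp_neg_le_quadratic {s : ℝ} (hs : 0 ≤ s) : Real.exp (-s) ≤ 1 - s + s ^ 2 / 2 := by
  have h1 := Real.quadratic_le_exp_of_nonneg hs
  rw [Real.exp_neg, inv_le_iff_one_le_mul₀ (Real.exp_pos s)]
  have h2 : 0 ≤ 1 - s + s ^ 2 / 2 := by nlinarith [sq_nonneg (s - 1)]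
  nlinarith [mul_le_mul_of_nonneg_left h1 h2, sq_nonneg (s ^ 2)]

/-- The `[2/1]` Padé approximant of `exp` is an upper bound (denominator cleared). -/
theorem Real.mul_exp_le_pade (t : ℝ) : (6 - 2 * t) * Real.exp t ≤ 6 + 4 * t + t ^ 2 := by
  let F : ℝ → ℝ := fun t => (6 + 4 * t + t ^ 2) * Real.exp (-t) + 2 * t
  have hd : ∀ x, HasDerivAt F (2 - Real.exp (-x) * (2 + 2 * x + x ^ 2)) x := by
    intro x
    have h1 : HasDerivAt (fun t : ℝ => 6 + 4 * t + t ^ 2) (4 + 2 * x) x := by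
      simpa using (((hasDerivAt_id x).const_mul 4).const_add 6).fun_add (hasDerivAt_pow 2 x)
    have h2 : HasDerivAt (fun t : ℝ => Real.exp (-t)) (-Real.exp (-x)) x := by
      simpa using (hasDerivAt_neg x).exp
    have h3 : HasDerivAt (fun t : ℝ => 2 * t) 2 x := by
      simpa using (hasDerivAt_id x).const_mul 2
    exact ((h1.fun_mul h2).fun_add h3).congr_deriv (by ring)
  have hcont : Continuous F := by fun_prop
  have hmin : F 0 ≤ F t := by
    rcases le_total 0 t with ht | ht
    · refine monotoneOn_of_hasDerivWithinAt_nonneg (convex_Ici 0) hcont.continuousOn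
        (fun x _ => (hd x).hasDerivWithinAt) (fun x hx => ?_) Set.self_mem_Ici ht ht
      rw [interior_Ici] at hx
      have h1 := mul_le_mul_of_nonneg_left (Real.quadratic_le_exp_of_nonneg (le_of_lt hx))
        (Real.exp_pos (-x)).le
      rw [← Real.exp_add, neg_add_cancel, Real.exp_zero] at h1
      linarith
    · refine antitoneOn_of_hasDerivWithinAt_nonpos (convex_Iic 0) hcont.continuousOn
        (fun x _ => (hd x).hasDerivWithinAt) (fun x hx => ?_) ht Set.self_mem_Iic ht
      rw [interior_Iic] at hx
      have h0 := Real.exp_neg_le_quadratic (neg_nonneg.2 (le_of_lt hx))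
      rw [neg_neg] at h0
      have h1 := mul_le_mul_of_nonneg_left h0 (Real.exp_pos (-x)).le
      rw [← Real.exp_add, neg_add_cancel, Real.exp_zero] at h1
      linarith
  have hF : 6 - 2 * t ≤ (6 + 4 * t + t ^ 2) * Real.exp (-t) := by
    simp only [F, neg_zero, Real.exp_zero] at hmin
    linarith
  have h := mul_le_mul_of_nonneg_right hF (Real.exp_pos t).le
  rwa [mul_assoc, ← Real.exp_add, neg_add_cancel, Real.exp_zero, mul_one] at h

/-- Bernstein's bound on the exponential, for arguments at most `c < 3`. -/
theorem Real.exp_le_bernstein {t c : ℝ} (htc : t ≤ c) (hc : c < 3) :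
    Real.exp t ≤ 1 + t + t ^ 2 / (2 * (1 - c / 3)) := by
  have h1 : Real.exp t ≤ 1 + t + t ^ 2 / (2 * (1 - t / 3)) := by
    have h : 0 < 6 - 2 * t := by linarith
    have h' : 1 + t + t ^ 2 / (2 * (1 - t / 3)) = (6 + 4 * t + t ^ 2) / (6 - 2 * t) := by
      have h3 : 2 * (1 - t / 3) = (6 - 2 * t) / 3 := by ring
      rw [h3, div_div_eq_mul_div, eq_div_iff h.ne', add_mul, div_mul_cancel₀ _ h.ne']
      ring
    rw [h', le_div_iff₀ h, mul_comm]
    exact Real.mul_exp_le_pade t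
  have h2 : t ^ 2 / (2 * (1 - t / 3)) ≤ t ^ 2 / (2 * (1 - c / 3)) :=
    div_le_div_of_nonneg_left (sq_nonneg t) (by linarith) (by linarith)
  linarith

/-- Fenchel–Young inequality for `q ↦ q * log (q / p)`. -/
theorem mul_sub_mul_exp_le_mul_log_div {p q : ℝ} (hp : 0 < p) (hq : 0 < q) (t : ℝ) :
    q * t - p * Real.exp t + q ≤ q * Real.log (q / p) := by
  have h := Real.add_one_le_exp (t - Real.log (q / p))
  rw [Real.exp_sub, Real.exp_log (div_pos hq hp)] at h
  have h2 := mul_le_mul_of_nonneg_left h hq.le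
  have h3 : q * (Real.exp t / (q / p)) = p * Real.exp t := by field_simp
  linarith

theorem le_sqrt_of_forall_le_add_div {D K V : ℝ} (hK : 0 ≤ K) (hV : 0 ≤ V)
    (h : ∀ u, 0 < u → D ≤ K * u + V / (2 * u)) : D ≤ Real.sqrt (2 * V * K) := by
  rcases le_total D 0 with hD | hD
  · exact hD.trans (Real.sqrt_nonneg _)
  apply Real.le_sqrt_of_sq_le
  have hq : ∀ u : ℝ, 0 ≤ (2 * K) * (u * u) + (-(2 * D)) * u + V := by
    intro u
    rcases le_or_gt u 0 with hu | hu
    · nlinarith [mul_nonneg hK (mul_self_nonneg u), mul_nonneg hD (neg_nonneg.2 hu)]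
    · have h1 := mul_le_mul_of_nonneg_right (h u hu) (by positivity : 0 ≤ 2 * u)
      rw [add_mul, div_mul_cancel₀ _ (by positivity : 2 * u ≠ 0)] at h1
      linarith
  have := discrim_le_zero hq
  unfold discrim at this
  linarith

section Dist
variable {X : Type*} [Fintype X] {P Q : X → ℝ}

theorem distVar_nonneg (hP : IsDist P) (f : X → ℝ) : 0 ≤ distVar P f :=
  sum_nonneg fun x _ => mul_nonneg (hP.1 x) (sq_nonneg _)

theorem sum_mul_sub_distMean (hQ : IsDist Q) (f : X → ℝ) (m : ℝ) :
    ∑ x, Q x * (f x - m) = distMean Q f - m := by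
  simp_rw [mul_sub, sum_sub_distrib, ← sum_mul, hQ.2, one_mul, distMean]

/-- Variational lower bound on the Kullback–Leibler divergence. -/
theorem sum_mul_sub_sum_mul_exp_le_distKL (hP : IsDist P) (hQ : IsDist Q) (hQP : AbsCont Q P)
    (g : X → ℝ) : ∑ x, Q x * g x - ∑ x, P x * Real.exp (g x) + 1 ≤ distKL Q P := by
  rw [← hQ.2, ← sum_sub_distrib, ← sum_add_distrib]
  refine sum_le_sum fun x _ => ?_
  split_ifs with hq
  · have hp : 0 < P x := (hP.1 x).lt_of_ne' fun h => hq.ne' (hQP x h)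
    exact mul_sub_mul_exp_le_mul_log_div hp hq _
  · have hq0 : Q x = 0 := le_antisymm (not_lt.1 hq) (hQ.1 x)
    have := mul_nonneg (hP.1 x) (Real.exp_pos (g x)).le
    rw [hq0]
    linarith

theorem distKL_nonneg (hP : IsDist P) (hQ : IsDist Q) (hQP : AbsCont Q P) : 0 ≤ distKL Q P := by
  simpa [hP.2] using sum_mul_sub_sum_mul_exp_le_distKL hP hQ hQP 0

theorem sub_distMean_le_distSpan [Nonempty X] (hP : IsDist P) (f : X → ℝ) (x : X) :
    f x - distMean P f ≤ distSpan f := by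
  have h1 : f x ≤ univ.sup' univ_nonempty f := le_sup' f (mem_univ x)
  have h2 : univ.inf' univ_nonempty f ≤ distMean P f := by
    calc univ.inf' univ_nonempty f = ∑ y, P y * univ.inf' univ_nonempty f := by
          rw [← sum_mul, hP.2, one_mul]
      _ ≤ distMean P f := sum_le_sum fun y _ =>
          mul_le_mul_of_nonneg_left (inf'_le f (mem_univ y)) (hP.1 y)
  unfold distSpan
  linarith

theorem distSpan_nonneg [Nonempty X] (f : X → ℝ) : 0 ≤ distSpan f :=
  let x := Classical.arbitrary X
  sub_nonneg.2 ((inf'_le f (mem_univ x)).trans (le_sup' f (mem_univ x)))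

/-- Bernstein's bound on the moment generating function of a centred function. -/
theorem sum_mul_exp_le_bernstein (hP : IsDist P) (f : X → ℝ) {b l : ℝ}
    (hb : ∀ x, f x - distMean P f ≤ b) (hl : 0 ≤ l) (hlb : l * b < 3) :
    ∑ x, P x * Real.exp (l * (f x - distMean P f)) ≤
      1 + l ^ 2 * distVar P f / (2 * (1 - l * b / 3)) := by
  calc ∑ x, P x * Real.exp (l * (f x - distMean P f))
      ≤ ∑ x, P x * (1 + l * (f x - distMean P f) +
          (l * (f x - distMean P f)) ^ 2 / (2 * (1 - l * b / 3))) :=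
        sum_le_sum fun x _ => mul_le_mul_of_nonneg_left
          (Real.exp_le_bernstein (mul_le_mul_of_nonneg_left (hb x) hl) hlb) (hP.1 x)
    _ = ∑ x, P x + l * ∑ x, P x * (f x - distMean P f) +
          l ^ 2 * distVar P f / (2 * (1 - l * b / 3)) := by
        rw [distVar, mul_sum, mul_sum, sum_div, ← sum_add_distrib, ← sum_add_distrib]
        exact sum_congr rfl fun x _ => by ring
    _ = 1 + l ^ 2 * distVar P f / (2 * (1 - l * b / 3)) := by
        rw [hP.2, sum_mul_sub_distMean hP, sub_self, mul_zero, add_zero]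

theorem distMean_sub_distMean_le (hP : IsDist P) (hQ : IsDist Q) (hQP : AbsCont Q P)
    (f : X → ℝ) {b u : ℝ} (hb : ∀ x, f x - distMean P f ≤ b) (hb0 : 0 ≤ b) (hu : 0 < u) :
    distMean Q f - distMean P f ≤ distKL Q P * (u + b / 3) + distVar P f / (2 * u) := by
  have hv : 0 < u + b / 3 := by positivity
  have hlb : (u + b / 3)⁻¹ * b < 3 := by
    rw [inv_mul_lt_iff₀ hv]
    linarith
  have h1 := sum_mul_exp_le_bernstein hP f hb (inv_pos.2 hv).le hlb
  have h2 := sum_mul_sub_sum_mul_exp_le_distKL hP hQ hQP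
    (fun x => (u + b / 3)⁻¹ * (f x - distMean P f))
  simp_rw [mul_left_comm (Q _), ← mul_sum, sum_mul_sub_distMean hQ] at h2
  have h3 : (u + b / 3) * ((u + b / 3)⁻¹ ^ 2 * distVar P f /
      (2 * (1 - (u + b / 3)⁻¹ * b / 3))) = distVar P f / (2 * u) := by
    have h4 : 1 - (u + b / 3)⁻¹ * b / 3 = u * (u + b / 3)⁻¹ := by
      field_simp
      ring
    rw [h4]
    generalize u + b / 3 = v at hv
    field_simp
  have h5 : (u + b / 3)⁻¹ * (distMean Q f - distMean P f) ≤ distKL Q P +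
      (u + b / 3)⁻¹ ^ 2 * distVar P f / (2 * (1 - (u + b / 3)⁻¹ * b / 3)) := by linarith
  rw [inv_mul_le_iff₀ hv, mul_add, h3] at h5
  linarith

end Dist

/-- Bernstein transportation (upper part): for `Q ≪ P`,
`E_Q[f] − E_P[f] ≤ √(2 V_P(f) KL(Q,P)) + (2/3) span(f) KL(Q,P)`. -/
theorem bernstein_transportation_upper {X : Type*} [Fintype X] [Nonempty X]
    (P Q : X → ℝ) (hP : IsDist P) (hQ : IsDist Q) (hQP : AbsCont Q P) (f : X → ℝ) :
    distMean Q f - distMean P f ≤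
      Real.sqrt (2 * distVar P f * distKL Q P) + (2 / 3) * distSpan f * distKL Q P := by
  have hK := distKL_nonneg hP hQ hQP
  have h := le_sqrt_of_forall_le_add_div
    (D := distMean Q f - distMean P f - distSpan f / 3 * distKL Q P) hK (distVar_nonneg hP f)
    fun u hu => by
      linarith [distMean_sub_distMean_le hP hQ hQP f (sub_distMean_le_distSpan hP f)
        (distSpan_nonneg f) hu]
  linarith [mul_nonneg (distSpan_nonneg f) hK]
end

section
/- Let X be a finite nonempty set and let P and Q be probability distributions on X with P ≪ Q. Then KL(P,Q) ≥ (1/2)·Σ_{x : P(x) ≠ Q(x)} (P(x) − Q(x))² / max(P(x), Q(x)). -/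
open Finset

theorem add_sq_div_two_le_neg_log_one_sub {u : ℝ} (h0 : 0 ≤ u) (h1 : u < 1) :
    u + u ^ 2 / 2 ≤ -Real.log (1 - u) := by
  have h := Real.hasSum_pow_div_log_of_abs_lt_one (abs_lt.2 ⟨by linarith, h1⟩)
  have h2 := sum_le_hasSum (range 2) (fun i _ => by positivity) h
  norm_num [sum_range_succ] at h2
  exact h2

theorem sq_div_max_le_mul_log_sub_add {p q : ℝ} (hp : 0 < p) (hq : 0 < q) :
    1 / 2 * ((p - q) ^ 2 / max p q) ≤ p * Real.log (p / q) - p + q := by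
  rcases le_total q p with h | h
  · rw [max_eq_left h]
    have key := add_sq_div_two_le_neg_log_one_sub (u := 1 - q / p)
      (sub_nonneg.2 ((div_le_one hp).2 h)) (by linarith [div_pos hq hp])
    rw [sub_sub_cancel, ← Real.log_inv, inv_div] at key
    have key' := mul_le_mul_of_nonneg_left key hp.le
    have e : p * (1 - q / p + (1 - q / p) ^ 2 / 2) = p - q + 1 / 2 * ((p - q) ^ 2 / p) := by
      field_simp
    linarith
  · rw [max_eq_right h]
    have key := Real.sinh_le_self_iff.2
      (Real.log_nonpos (div_pos hp hq).le ((div_le_one hq).2 h))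
    rw [Real.sinh_log (div_pos hp hq)] at key
    have key' := mul_le_mul_of_nonneg_left key hp.le
    have e : p * ((p / q - (p / q)⁻¹) / 2) = p - q + 1 / 2 * ((p - q) ^ 2 / q) := by
      field_simp
      ring
    linarith

/-- Local Pinsker inequality:
`KL(P,Q) ≥ (1/2) ∑_{x : P(x) ≠ Q(x)} (P(x) − Q(x))² / max(P(x), Q(x))`. -/
theorem refined_pinsker {X : Type*} [Fintype X] [Nonempty X]
    (P Q : X → ℝ) (hP : IsDist P) (hQ : IsDist Q) (hPQ : AbsCont P Q) :
    (1 / 2) * ∑ x, (if P x ≠ Q x then (P x - Q x) ^ 2 / max (P x) (Q x) else 0)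
      ≤ distKL P Q := by
  have pointwise (x : X) :
      1 / 2 * (if P x ≠ Q x then (P x - Q x) ^ 2 / max (P x) (Q x) else 0)
        ≤ (if 0 < P x then P x * Real.log (P x / Q x) else 0) + (Q x - P x) := by
    rcases (hP.1 x).eq_or_lt with hp | hp
    · rcases (hQ.1 x).eq_or_lt with hq | hq
      · simp [← hp, ← hq]
      · rw [← hp, if_pos hq.ne, max_eq_right hq.le, if_neg (lt_irrefl 0)]
        have e : (0 - Q x) ^ 2 / Q x = Q x := by field_simp; ring
        linarith
    · have hq : 0 < Q x := (hQ.1 x).lt_of_ne' fun h => hp.ne' (hPQ x h)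
      have key := sq_div_max_le_mul_log_sub_add hp hq
      rw [if_pos hp]
      split_ifs with h
      · linarith
      · rw [not_not.1 h]
        simp [hq.ne']
  have total := sum_le_sum fun x (_ : x ∈ univ) => pointwise x
  rw [← mul_sum, sum_add_distrib, sum_sub_distrib, hP.2, hQ.2, sub_self, add_zero] at total
  exact total
end

section
/- Let X be a finite nonempty set and let P and Q be probability distributions on X with Q ≪ P. Then for every x ∈ X, |P(x) − Q(x)| ≤ √(2·max(P(x), Q(x))·KL(Q,P)). -/
open Finset

/-- Quadratic lower bound for the integrand of the Kullback-Leibler divergence. -/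
lemma sq_sub_le_two_mul_max_mul {p q : ℝ} (hp : 0 ≤ p) (hq : 0 ≤ q) (hqp : p = 0 → q = 0) :
    (p - q) ^ 2 ≤ 2 * max p q * (q * Real.log (q / p) + p - q) := by
  rcases hq.eq_or_lt with rfl | hq0
  · simp only [max_eq_left hp, zero_mul]
    nlinarith [sq_nonneg p]
  have hp0 : 0 < p := hp.lt_of_ne fun h => hq0.ne' (hqp h.symm)
  rcases le_total q p with h | h
  · have hlog : Real.log (p / q) ≤ (p / q - q / p) / 2 := by
      have hsinh := Real.self_le_sinh_iff.2 (Real.log_nonneg ((one_le_div hq0).2 h))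
      rwa [Real.sinh_log (div_pos hp0 hq0), inv_div] at hsinh
    have hneg : Real.log (q / p) = -Real.log (p / q) := by rw [← Real.log_inv, inv_div]
    rw [max_eq_left h, hneg]
    calc (p - q) ^ 2 = 2 * p * (q * -((p / q - q / p) / 2) + p - q) := by field_simp; ring
      _ ≤ _ := by gcongr
  · have hlog : 2 * (q - p) / (q + p) ≤ Real.log (q / p) := by
      have hadd := Real.le_log_one_add_of_nonneg (x := (q - p) / p)
        (div_nonneg (sub_nonneg.2 h) hp)
      have h1 : 1 + (q - p) / p = q / p := by field_simp; ring
      have h2 : 2 * ((q - p) / p) / ((q - p) / p + 2) = 2 * (q - p) / (q + p) := by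
        have : (q - p) / p + 2 = (q + p) / p := by field_simp; ring
        rw [this]
        field_simp
      rwa [h1, h2] at hadd
    rw [max_eq_right h]
    calc (p - q) ^ 2 ≤ 2 * q * ((q - p) ^ 2 / (q + p)) := by
          rw [← mul_div_assoc, le_div_iff₀ (by positivity)]
          nlinarith [mul_nonneg (sq_nonneg (p - q)) (sub_nonneg.2 h)]
      _ = 2 * q * (q * (2 * (q - p) / (q + p)) + p - q) := by field_simp; ring
      _ ≤ _ := by gcongr

lemma mul_log_div_add_sub_nonneg {p q : ℝ} (hp : 0 ≤ p) (hq : 0 ≤ q) (hqp : p = 0 → q = 0) :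
    0 ≤ q * Real.log (q / p) + p - q := by
  rcases hp.eq_or_lt with rfl | hp0
  · simp [hqp rfl]
  · have hmax : 0 < 2 * max p q := by positivity
    exact nonneg_of_mul_nonneg_right
      ((sq_nonneg _).trans (sq_sub_le_two_mul_max_mul hp hq hqp)) hmax

lemma distKL_eq_sum {X : Type*} [Fintype X] {P Q : X → ℝ} (hP : IsDist P) (hQ : IsDist Q) :
    distKL Q P = ∑ x, (Q x * Real.log (Q x / P x) + P x - Q x) := by
  rw [sum_sub_distrib, sum_add_distrib, hP.2, hQ.2, add_sub_cancel_right, distKL]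
  refine sum_congr rfl fun x _ => ?_
  split_ifs with h
  · rfl
  · simp [le_antisymm (not_lt.1 h) (hQ.1 x)]

/-- Pointwise consequence of the local Pinsker inequality: for `Q ≪ P` and every `x`,
`|P(x) − Q(x)| ≤ √(2 max(P(x), Q(x)) KL(Q,P))`. -/
theorem abs_sub_le_sqrt_KL {X : Type*} [Fintype X] [Nonempty X]
    (P Q : X → ℝ) (hP : IsDist P) (hQ : IsDist Q) (hQP : AbsCont Q P) (x : X) :
    |P x - Q x| ≤ Real.sqrt (2 * max (P x) (Q x) * distKL Q P) := by
  refine Real.abs_le_sqrt ((sq_sub_le_two_mul_max_mul (hP.1 x) (hQ.1 x) (hQP x)).trans ?_)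
  rw [distKL_eq_sum hP hQ]
  refine mul_le_mul_of_nonneg_left ?_ (mul_nonneg zero_le_two (le_max_of_le_left (hP.1 x)))
  exact single_le_sum (f := fun y => Q y * Real.log (Q y / P y) + P y - Q y)
    (fun y _ => mul_log_div_add_sub_nonneg (hP.1 y) (hQ.1 y) (hQP y)) (mem_univ x)
end

section
/- Let X be a finite nonempty set and let P and Q be probability distributions on X with P ≪ Q. Then Σ_{x : Q(x) ≥ P(x), Q(x) > 0} (Q(x) − P(x))² / Q(x) ≤ 2·KL(P,Q). -/
open Finset

/-- On `(0, 1]` the logarithm is bounded below by `sinh (log t) = (t - t⁻¹) / 2`. -/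
theorem half_sub_inv_le_log {t : ℝ} (ht : 0 < t) (ht1 : t ≤ 1) :
    (t - t⁻¹) / 2 ≤ Real.log t := by
  rw [← Real.sinh_log ht]
  exact Real.sinh_le_self_iff.2 (Real.log_nonpos ht.le ht1)

theorem sq_sub_one_half_le_mul_log {t : ℝ} (ht : 0 ≤ t) (ht1 : t ≤ 1) :
    (t ^ 2 - 1) / 2 ≤ t * Real.log t := by
  rcases ht.eq_or_lt with rfl | ht
  · norm_num
  · calc (t ^ 2 - 1) / 2 = t * ((t - t⁻¹) / 2) := by field_simp
      _ ≤ t * Real.log t := by gcongr; exact half_sub_inv_le_log ht ht1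

theorem sub_one_le_mul_log {t : ℝ} (ht : 0 < t) : t - 1 ≤ t * Real.log t := by
  calc t - 1 = t * (1 - t⁻¹) := by field_simp
    _ ≤ t * Real.log t := by gcongr; exact Real.one_sub_inv_le_log_of_pos ht

/-- Local form of the comparison between the truncated `χ²`-divergence and the relative entropy. -/
theorem sq_sub_div_le_two_mul_log_div {p q : ℝ} (hp : 0 ≤ p) (hq : 0 < q) :
    (if p ≤ q then (q - p) ^ 2 / q else 0) ≤ 2 * (p * Real.log (p / q) - p + q) := by
  obtain ⟨t, rfl⟩ : ∃ t, p = q * t := ⟨p / q, by field_simp⟩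
  have ht : 0 ≤ t := nonneg_of_mul_nonneg_right hp hq
  rw [mul_div_cancel_left₀ t hq.ne']
  split_ifs with h
  · have ht1 : t ≤ 1 := by nlinarith
    calc (q - q * t) ^ 2 / q = q * (1 - t) ^ 2 := by field_simp
      _ ≤ q * (2 * (t * Real.log t - t + 1)) := by
        gcongr
        linarith [sq_sub_one_half_le_mul_log ht ht1]
      _ = 2 * (q * t * Real.log t - q * t + q) := by ring
  · have ht1 : 1 < t := by nlinarith
    have := mul_nonneg hq.le (sub_nonneg.2 (sub_one_le_mul_log (one_pos.trans ht1)))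
    linarith

/-- For `P ≪ Q`: `∑_{x : Q(x) ≥ P(x), Q(x) > 0} (Q(x) − P(x))² / Q(x) ≤ 2 KL(P,Q)`. -/
theorem chi_sq_le_two_KL {X : Type*} [Fintype X] [Nonempty X]
    (P Q : X → ℝ) (hP : IsDist P) (hQ : IsDist Q) (hPQ : AbsCont P Q) :
    ∑ x, (if P x ≤ Q x ∧ 0 < Q x then (Q x - P x) ^ 2 / Q x else 0)
      ≤ 2 * distKL P Q := by
  have hKL : 2 * distKL P Q =
      ∑ x, 2 * ((if 0 < P x then P x * Real.log (P x / Q x) else 0) - P x + Q x) := by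
    rw [← mul_sum, sum_add_distrib, sum_sub_distrib, hP.2, hQ.2, distKL]
    ring
  rw [hKL]
  refine sum_le_sum fun x _ => ?_
  have hlog : (if 0 < P x then P x * Real.log (P x / Q x) else 0) =
      P x * Real.log (P x / Q x) := by
    split_ifs with h
    · rfl
    · simp [le_antisymm (not_lt.1 h) (hP.1 x)]
  rw [hlog]
  rcases (hQ.1 x).eq_or_lt with h | h
  · simp [← h, hPQ x h.symm]
  · simpa only [h, and_true] using sq_sub_div_le_two_mul_log_div (hP.1 x) h
end

section
/- Let X be a finite nonempty set, let P and Q be probability distributions on X with P ≪ Q, and let f : X → ℝ. Then Σ_{x : Q(x) ≥ P(x)} (f(x) − E_Q[f])·(Q(x) − P(x)) ≤ √(2·V_{Q,P}(f)·KL(P,Q)). -/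
open Finset

/-- The pointwise form of the bound `KL(P,Q) ≥ ½ ∑_{P ≤ Q} (Q - P)² / Q`. -/
theorem sq_div_le_two_mul_klTerm {p q : ℝ} (hp : 0 ≤ p) (hq : 0 ≤ q) (hpq : q = 0 → p = 0) :
    (if p ≤ q then (q - p) ^ 2 / q else 0)
      ≤ 2 * ((if 0 < p then p * Real.log (p / q) else 0) + (q - p)) := by
  rcases hp.eq_or_lt with rfl | hp
  · rcases hq.eq_or_lt with rfl | hq
    · simp
    · have : (q - 0) ^ 2 / q = q := by field_simp; ring
      rw [if_pos hq.le, this]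
      simp only [lt_irrefl, if_false]
      linarith
  · have hq : 0 < q := lt_of_le_of_ne hq fun h => hp.ne' (hpq h.symm)
    have hlog : Real.log (p / q) = -Real.log (q / p) := by
      rw [← Real.log_inv, inv_div]
    rw [if_pos hp, hlog]
    split_ifs with h
    · have hs : Real.log (q / p) ≤ (q / p - (q / p)⁻¹) / 2 := by
        rw [← Real.sinh_log (by positivity), Real.self_le_sinh_iff]
        exact Real.log_nonneg ((one_le_div hp).2 h)
      have hm := mul_le_mul_of_nonneg_left hs hp.le
      have e : p * ((q / p - (q / p)⁻¹) / 2) = (q - p ^ 2 / q) / 2 := by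
        field_simp
      have e' : (q - p) ^ 2 / q = q - 2 * p + p ^ 2 / q := by
        field_simp
        ring
      rw [e']
      linarith
    · have hs := Real.log_le_sub_one_of_pos (div_pos hq hp)
      have hm := mul_le_mul_of_nonneg_left hs hp.le
      have e : p * (q / p - 1) = q - p := by field_simp
      linarith

/-- The part of the `χ²`-divergence where `P ≤ Q` is at most `2 KL(P,Q)`. -/
theorem sum_sq_div_le_two_mul_distKL {X : Type*} [Fintype X] {P Q : X → ℝ}
    (hP : IsDist P) (hQ : IsDist Q) (hPQ : AbsCont P Q) :
    ∑ x, (if P x ≤ Q x then (Q x - P x) ^ 2 / Q x else 0) ≤ 2 * distKL P Q := by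
  calc
    _ ≤ ∑ x, 2 * ((if 0 < P x then P x * Real.log (P x / Q x) else 0) + (Q x - P x)) :=
      sum_le_sum fun x _ => sq_div_le_two_mul_klTerm (hP.1 x) (hQ.1 x) (hPQ x)
    _ = 2 * distKL P Q := by
      rw [← mul_sum, sum_add_distrib, sum_sub_distrib, hP.2, hQ.2, sub_self, add_zero, distKL]

/-- For `P ≪ Q`:
`∑_{x : Q(x) ≥ P(x)} (f(x) − E_Q[f]) (Q(x) − P(x)) ≤ √(2 V_{Q,P}(f) KL(P,Q))`. -/
theorem upper_part_transport {X : Type*} [Fintype X] [Nonempty X]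
    (P Q : X → ℝ) (hP : IsDist P) (hQ : IsDist Q) (hPQ : AbsCont P Q) (f : X → ℝ) :
    ∑ x, (if P x ≤ Q x then (f x - distMean Q f) * (Q x - P x) else 0)
      ≤ Real.sqrt (2 * Vloc Q P f * distKL P Q) := by
  have hterm (x : X) : 0 ≤ if P x ≤ Q x then Q x * (f x - distMean Q f) ^ 2 else 0 := by
    have := hQ.1 x
    split_ifs <;> positivity
  have hcs : (∑ x, if P x ≤ Q x then (f x - distMean Q f) * (Q x - P x) else 0) ^ 2
      ≤ Vloc Q P f * ∑ x, if P x ≤ Q x then (Q x - P x) ^ 2 / Q x else 0 := by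
    refine sum_sq_le_sum_mul_sum_of_sq_le_mul univ (fun x _ => hterm x) (fun x _ => ?_)
      fun x _ => le_of_eq ?_
    · have := hQ.1 x
      split_ifs <;> positivity
    · split_ifs
      · by_cases h : Q x = 0
        · simp [h, hPQ x h]
        · field_simp
      · simp
  refine (le_abs_self _).trans (Real.abs_le_sqrt (hcs.trans ?_))
  calc
    _ ≤ Vloc Q P f * (2 * distKL P Q) :=
      mul_le_mul_of_nonneg_left (sum_sq_div_le_two_mul_distKL hP hQ hPQ)
        (sum_nonneg fun x _ => hterm x)
    _ = 2 * Vloc Q P f * distKL P Q := by ring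
end

section
/- Let n ≥ 1 and let z_1, …, z_n be real numbers. For 0 ≤ j ≤ n set Z_j = max(1, Σ_{i=1}^{j} z_i) (so Z_0 = 1). Assume 0 ≤ z_k ≤ Z_{k−1} for every 1 ≤ k ≤ n. Then Σ_{k=1}^{n} z_k / Z_{k−1} ≤ 2·log(Z_n) + 1. -/
theorem le_two_mul_log_one_add {x : ℝ} (h0 : 0 ≤ x) (h1 : x ≤ 1) :
    x ≤ 2 * Real.log (1 + x) := by
  have hpos : 0 < 1 + x := by linarith
  have hlog := Real.one_sub_inv_le_log_of_pos hpos
  have hinv : (1 + x)⁻¹ ≤ 1 - x / 2 := by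
    rw [inv_le_iff_one_le_mul₀ hpos]
    nlinarith
  linarith

/-- One step of the potential argument with potential `2 * log (max 1 s) + min 1 s`. -/
theorem div_max_one_add_potential_le {s z : ℝ} (hz0 : 0 ≤ z) (hz : z ≤ max 1 s) :
    2 * Real.log (max 1 s) + min 1 s + z / max 1 s
      ≤ 2 * Real.log (max 1 (s + z)) + min 1 (s + z) := by
  rcases le_total 1 s with h | h
  · rw [max_eq_right h] at hz ⊢
    have hs : 0 < s := by linarith
    rw [max_eq_right (by linarith), min_eq_left h, min_eq_left (by linarith),
      show s + z = s * (1 + z / s) by field_simp,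
      Real.log_mul hs.ne' (by positivity)]
    linarith [le_two_mul_log_one_add (div_nonneg hz0 hs.le) ((div_le_one hs).2 hz)]
  · rw [max_eq_left h] at hz ⊢
    rw [min_eq_right h, Real.log_one, div_one]
    rcases le_total 1 (s + z) with h' | h'
    · rw [max_eq_right h', min_eq_left h']
      have key := le_two_mul_log_one_add (x := s + z - 1) (by linarith) (by linarith)
      rw [add_sub_cancel] at key
      linarith
    · rw [max_eq_left h', min_eq_right h', Real.log_one]
      linarith

theorem sum_div_partial_max_le_potential (n : ℕ) (z Z : ℕ → ℝ)
    (hZ : ∀ j, Z j = max 1 (∑ i ∈ Finset.Icc 1 j, z i))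
    (hz : ∀ k, 1 ≤ k → k ≤ n → 0 ≤ z k ∧ z k ≤ Z (k - 1)) :
    ∑ k ∈ Finset.Icc 1 n, z k / Z (k - 1)
      ≤ 2 * Real.log (Z n) + min 1 (∑ i ∈ Finset.Icc 1 n, z i) := by
  induction n with
  | zero => simp [hZ]
  | succ m ih =>
    have ih' := ih fun k h1 h2 => hz k h1 (by omega)
    obtain ⟨h0, h1⟩ := hz (m + 1) (by omega) le_rfl
    rw [Nat.add_sub_cancel, hZ m] at h1
    have step := div_max_one_add_potential_le h0 h1
    rw [hZ m] at ih'
    rw [hZ (m + 1), Finset.sum_Icc_succ_top (by omega), Finset.sum_Icc_succ_top (by omega),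
      Nat.add_sub_cancel, hZ m]
    linarith

/-- If `0 ≤ z_k ≤ Z_{k-1}` with `Z_j = max(1, z_1 + ⋯ + z_j)`, then
`∑_{k=1}^n z_k / Z_{k-1} ≤ 2 log(Z_n) + 1`. -/
theorem sum_div_partial_max_le (n : ℕ) (hn : 1 ≤ n) (z : ℕ → ℝ)
    (Z : ℕ → ℝ) (hZ : ∀ j, Z j = max 1 (∑ i ∈ Finset.Icc 1 j, z i))
    (hz : ∀ k, 1 ≤ k → k ≤ n → 0 ≤ z k ∧ z k ≤ Z (k - 1)) :
    ∑ k ∈ Finset.Icc 1 n, z k / Z (k - 1) ≤ 2 * Real.log (Z n) + 1 :=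
  (sum_div_partial_max_le_potential n z Z hZ hz).trans
    (add_le_add_right (min_le_left _ _) _)
end

section
/- Let n ≥ 1, let P be an n×n row-stochastic real matrix, let μ ∈ ℝ^n, and suppose P̄ is an n×n real matrix such that (1/T)·Σ_{t=1}^{T} P^{t−1} converges entrywise to P̄ as T → ∞. Define the gain g = P̄·μ ∈ ℝ^n, and suppose b ∈ ℝ^n is such that the partial sums Σ_{t=1}^{m} (P^{t−1} − P̄)·μ converge entrywise to b as m → ∞. Then b + g = μ + P·b (Bellman equation). -/
open Filter Topology in
/-- If the partial sums `∑ t < m, (P ^ t μ - g)` converge, then `g` is fixed by `P`, and the limit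
`b` satisfies the Poisson equation `b + g = μ + P b`. -/
theorem Matrix.add_eq_add_mulVec_of_tendsto_sum {ι : Type*} [Fintype ι] [DecidableEq ι]
    (P : Matrix ι ι ℝ) (μ g b : ι → ℝ)
    (hb : Tendsto (fun m : ℕ => ∑ t ∈ Finset.range m, ((P ^ t).mulVec μ - g)) atTop (𝓝 b)) :
    b + g = μ + P.mulVec b := by
  have hcont : Continuous fun v : ι → ℝ => P.mulVec v := by fun_prop
  have hb_succ := (tendsto_add_atTop_iff_nat 1).2 hb
  have hpow : Tendsto (fun t : ℕ => (P ^ t).mulVec μ) atTop (𝓝 g) := by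
    have h := (hb_succ.sub hb).add_const g
    simpa only [Finset.sum_range_succ, add_sub_cancel_left, sub_add_cancel, sub_self, zero_add]
      using h
  have hfix : P.mulVec g = g := by
    refine tendsto_nhds_unique ((hcont.tendsto g).comp hpow) ?_
    refine ((tendsto_add_atTop_iff_nat 1).2 hpow).congr fun t => ?_
    simp [pow_succ', Matrix.mulVec_mulVec]
  refine tendsto_nhds_unique (hb_succ.add_const g)
    ((((hcont.tendsto b).comp hb).const_add μ).congr fun m => ?_)
  rw [Finset.sum_range_succ', Function.comp_apply, Matrix.mulVec_sum]
  simp only [Matrix.mulVec_sub, hfix, Matrix.mulVec_mulVec, ← pow_succ', pow_zero,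
    Matrix.one_mulVec]
  abel


/-- Bellman equation for the gain `g = P̄ μ` and the bias
`b = ∑_{t≥1} (P^{t-1} − P̄) μ`: `b + g = μ + P b`. -/
theorem bias_gain_bellman {n : ℕ} (hn : 1 ≤ n)
    (P : Matrix (Fin n) (Fin n) ℝ)
    (hnonneg : ∀ i j, 0 ≤ P i j) (hrow : ∀ i, ∑ j, P i j = 1)
    (μ : Fin n → ℝ)
    (Pbar : Matrix (Fin n) (Fin n) ℝ)
    (hlim : ∀ i j, Filter.Tendsto
      (fun T : ℕ => (∑ t ∈ Finset.range T, P ^ t) i j / (T : ℝ))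
      Filter.atTop (nhds (Pbar i j)))
    (g : Fin n → ℝ) (hg : g = Pbar.mulVec μ)
    (b : Fin n → ℝ)
    (hb : ∀ i, Filter.Tendsto
      (fun m : ℕ => ∑ t ∈ Finset.range m, ((P ^ t - Pbar).mulVec μ) i)
      Filter.atTop (nhds (b i))) :
    b + g = μ + P.mulVec b := by
  subst hg
  refine P.add_eq_add_mulVec_of_tendsto_sum μ (Pbar.mulVec μ) b (tendsto_pi_nhds.2 fun i => ?_)
  simpa only [Finset.sum_apply, Matrix.sub_mulVec] using hb i
end

section
/- Let n ≥ 1, let P be an n×n row-stochastic real matrix, let μ ∈ ℝ^n, and suppose P̄ is an n×n real matrix such that (1/T)·Σ_{t=1}^{T} P^{t−1} converges entrywise to P̄ as T → ∞. Suppose b ∈ ℝ^n is such that the partial sums Σ_{t=1}^{m} (P^{t−1} − P̄)·μ converge entrywise to b as m → ∞, and suppose additionally that P^m·μ converges entrywise to P̄·μ as m → ∞. Then (I − P + P̄)·b = (I − P̄)·μ. -/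
open Filter Topology

theorem pow_mul_eq_of_mul_eq {M : Type*} [Monoid M] {p q : M} (h : p * q = q) (t : ℕ) :
    p ^ t * q = q := by
  induction t with
  | zero => simp
  | succ t ih => rw [pow_succ, mul_assoc, h, ih]

theorem mul_pow_eq_of_mul_eq {M : Type*} [Monoid M] {p q : M} (h : q * p = q) (t : ℕ) :
    q * p ^ t = q := by
  induction t with
  | zero => simp
  | succ t ih => rw [pow_succ, ← mul_assoc, ih, h]

/-- Telescoping of the deviations `p ^ t - q` against the fundamental element `1 - p + q`. -/
theorem fundamental_mul_sum_pow_sub {R : Type*} [Ring R] {p q : R}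
    (hpq : p * q = q) (hqp : q * p = q) (hqq : IsIdempotentElem q) (m : ℕ) :
    (1 - p + q) * ∑ t ∈ Finset.range m, (p ^ t - q) = 1 - p ^ m := by
  induction m with
  | zero => simp
  | succ m ih =>
    have hterm : (1 - p + q) * (p ^ m - q) = p ^ m - p ^ (m + 1) := by
      simp only [add_mul, sub_mul, mul_sub, one_mul, hpq, hqq.eq,
        mul_pow_eq_of_mul_eq hqp, pow_succ']
      abel
    rw [Finset.sum_range_succ, mul_add, ih, hterm]
    abel

section CesaroLimit

variable {A : Type*} [Ring A] [Algebra ℝ A] [TopologicalSpace A] [IsTopologicalRing A]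
  [ContinuousSMul ℝ A] {p q : A}

/-- If the Cesàro means of the powers of `p` converge, then `p ^ T / T` tends to zero. -/
theorem tendsto_inv_smul_pow_of_cesaro
    (h : Tendsto (fun T : ℕ => (T : ℝ)⁻¹ • ∑ t ∈ Finset.range T, p ^ t) atTop (𝓝 q)) :
    Tendsto (fun T : ℕ => (T : ℝ)⁻¹ • p ^ T) atTop (𝓝 0) := by
  have hinv : Tendsto (fun T : ℕ => 1 + (T : ℝ)⁻¹) atTop (𝓝 1) := by
    simpa using (tendsto_inv_atTop_nhds_zero_nat (𝕜 := ℝ)).const_add 1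
  have hdiff := (hinv.smul (h.comp (tendsto_add_atTop_nat 1))).sub h
  rw [one_smul, sub_self] at hdiff
  refine hdiff.congr' ?_
  filter_upwards [eventually_gt_atTop 0] with T hT
  have hT' : (T : ℝ) ≠ 0 := by exact_mod_cast hT.ne'
  have hcoeff : (1 + (T : ℝ)⁻¹) * ((T : ℝ) + 1)⁻¹ = (T : ℝ)⁻¹ := by
    have : (T : ℝ) + 1 ≠ 0 := by positivity
    field_simp
  simp only [Function.comp_apply, Nat.cast_add, Nat.cast_one, smul_smul, hcoeff,
    Finset.sum_range_succ, smul_add, add_sub_cancel_left]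

variable [T2Space A]

theorem mul_cesaro_limit
    (h : Tendsto (fun T : ℕ => (T : ℝ)⁻¹ • ∑ t ∈ Finset.range T, p ^ t) atTop (𝓝 q)) :
    p * q = q := by
  have hlim := (h.add (tendsto_inv_smul_pow_of_cesaro h)).sub
    ((tendsto_inv_atTop_nhds_zero_nat (𝕜 := ℝ)).smul_const (1 : A))
  rw [zero_smul, add_zero, sub_zero] at hlim
  refine tendsto_nhds_unique (h.const_mul p) (hlim.congr fun T => ?_)
  rw [mul_smul_comm, ← smul_add, ← smul_sub, ← Finset.sum_range_succ, Finset.sum_range_succ',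
    pow_zero, add_sub_cancel_right, Finset.mul_sum]
  simp only [pow_succ']

theorem cesaro_limit_mul
    (h : Tendsto (fun T : ℕ => (T : ℝ)⁻¹ • ∑ t ∈ Finset.range T, p ^ t) atTop (𝓝 q)) :
    q * p = q := by
  refine (tendsto_nhds_unique (h.mul_const p) ((h.const_mul p).congr fun T => ?_)).trans
    (mul_cesaro_limit h)
  exact (((Commute.sum_right _ _ _ fun t _ => Commute.pow_right rfl t).smul_right _)).eq

theorem isIdempotentElem_cesaro_limit
    (h : Tendsto (fun T : ℕ => (T : ℝ)⁻¹ • ∑ t ∈ Finset.range T, p ^ t) atTop (𝓝 q)) :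
    IsIdempotentElem q := by
  refine tendsto_nhds_unique (h.mul_const q) (tendsto_const_nhds.congr' ?_)
  filter_upwards [eventually_gt_atTop 0] with T hT
  have hT' : (T : ℝ) ≠ 0 := by exact_mod_cast hT.ne'
  rw [smul_mul_assoc, Finset.sum_mul,
    Finset.sum_congr rfl fun t _ => pow_mul_eq_of_mul_eq (mul_cesaro_limit h) t,
    Finset.sum_const, Finset.card_range, ← Nat.cast_smul_eq_nsmul ℝ, smul_smul,
    inv_mul_cancel₀ hT', one_smul]

end CesaroLimit

/-- Fundamental matrix identity for the bias `b = ∑_{t≥1} (P^{t-1} − P̄) μ`: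
`(I − P + P̄) b = (I − P̄) μ`. -/
theorem bias_fundamental_matrix {n : ℕ} (hn : 1 ≤ n)
    (P : Matrix (Fin n) (Fin n) ℝ)
    (hnonneg : ∀ i j, 0 ≤ P i j) (hrow : ∀ i, ∑ j, P i j = 1)
    (μ : Fin n → ℝ)
    (Pbar : Matrix (Fin n) (Fin n) ℝ)
    (hlim : ∀ i j, Filter.Tendsto
      (fun T : ℕ => (∑ t ∈ Finset.range T, P ^ t) i j / (T : ℝ))
      Filter.atTop (nhds (Pbar i j)))
    (b : Fin n → ℝ)
    (hb : ∀ i, Filter.Tendsto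
      (fun m : ℕ => ∑ t ∈ Finset.range m, ((P ^ t - Pbar).mulVec μ) i)
      Filter.atTop (nhds (b i)))
    (hPm : ∀ i, Filter.Tendsto
      (fun m : ℕ => ((P ^ m).mulVec μ) i)
      Filter.atTop (nhds ((Pbar.mulVec μ) i))) :
    (1 - P + Pbar).mulVec b = (1 - Pbar).mulVec μ := by
  have hces : Tendsto (fun T : ℕ => (T : ℝ)⁻¹ • ∑ t ∈ Finset.range T, P ^ t) atTop (𝓝 Pbar) := by
    refine tendsto_pi_nhds.2 fun i => tendsto_pi_nhds.2 fun j => (hlim i j).congr fun T => ?_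
    rw [Matrix.smul_apply, smul_eq_mul, div_eq_inv_mul]
  have hsum : Tendsto (fun m : ℕ => (∑ t ∈ Finset.range m, (P ^ t - Pbar)).mulVec μ)
      atTop (𝓝 b) := by
    refine tendsto_pi_nhds.2 fun i => (hb i).congr fun m => ?_
    rw [Matrix.sum_mulVec, Finset.sum_apply]
  have hcont : Continuous fun v : Fin n → ℝ => (1 - P + Pbar).mulVec v :=
    continuous_const.matrix_mulVec continuous_id
  have hright : Tendsto (fun m : ℕ => μ - (P ^ m).mulVec μ) atTop (𝓝 (μ - Pbar.mulVec μ)) :=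
    (tendsto_pi_nhds.2 hPm).const_sub μ
  rw [Matrix.sub_mulVec, Matrix.one_mulVec]
  refine tendsto_nhds_unique ((hcont.tendsto b).comp hsum) (hright.congr fun m => ?_)
  rw [Function.comp_apply, Matrix.mulVec_mulVec, fundamental_mul_sum_pow_sub
    (mul_cesaro_limit hces) (cesaro_limit_mul hces) (isIdempotentElem_cesaro_limit hces),
    Matrix.sub_mulVec, Matrix.one_mulVec]
end

section
/- Let S and A be nonempty finite sets, let μ : S × A → ℝ, and for each (s,a) ∈ S × A let p(·|s,a) be a probability distribution on S. Define the value iteration sequence u_0 = 0 and u_{n+1}(s) = max_{a ∈ A} ( μ(s,a) + Σ_{s'∈S} p(s'|s,a)·u_n(s') ). For a policy π : S → A, let Pπ be the S×S row-stochastic matrix with entries Pπ(s,s') = p(s'|s,π(s)) and let μπ(s) = μ(s,π(s)). Assume that for every policy π there is a matrix P̄π such that (1/T)·Σ_{t=1}^{T} Pπ^{t−1} converges entrywise to P̄π as T → ∞, and that the gain vector gπ := P̄π·μπ is a constant vector, with common value γπ; set γ⋆ = max_{π : S → A} γπ. Let n ∈ ℕ, let ε ≥ 0, and let π' : S → A be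 a policy such that for every s ∈ S, π'(s) attains the maximum in the definition of u_{n+1}(s). If span(u_{n+1} − u_n) ≤ ε, then: (i) γ⋆ − γ_{π'} ≤ ε; (ii) |u_{n+1}(s) − u_n(s) − γ⋆| ≤ ε for every s ∈ S; and (iii) |u_{n+1}(s) − u_n(s) − γ_{π'}| ≤ ε for every s ∈ S. -/
open Finset

/-- A row-stochastic matrix averages: if `f ≤ g` pointwise, then `P f ≤ P g` pointwise. -/
theorem mulVec_le_mulVec_of_mem_rowStochastic {S : Type*} [Fintype S] [DecidableEq S]
    {P : Matrix S S ℝ} (hP : P ∈ Matrix.rowStochastic ℝ S) {f g : S → ℝ} (hfg : ∀ s, f s ≤ g s)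
    (s : S) : P.mulVec f s ≤ P.mulVec g s :=
  Finset.sum_le_sum fun x _ => mul_le_mul_of_nonneg_left (hfg x) (hP.1 s x)

theorem mulVec_const_of_mem_rowStochastic {S : Type*} [Fintype S] [DecidableEq S]
    {P : Matrix S S ℝ} (hP : P ∈ Matrix.rowStochastic ℝ S) (c : ℝ) (s : S) :
    P.mulVec (fun _ => c) s = c := by
  simp only [Matrix.mulVec, dotProduct, ← Finset.sum_mul,
    Matrix.sum_row_of_mem_rowStochastic hP s, one_mul]

/-- If `r + P v ≤ v + c`, then the total reward `∑ t < T, Pᵗ r` is at most `T c + v - Pᵀ v`. -/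
theorem sum_pow_mulVec_le {S : Type*} [Fintype S] [DecidableEq S]
    {P : Matrix S S ℝ} (hP : P ∈ Matrix.rowStochastic ℝ S) {r v : S → ℝ} {c : ℝ}
    (h : ∀ s, r s + P.mulVec v s ≤ v s + c) (T : ℕ) (s : S) :
    (∑ t ∈ Finset.range T, P ^ t).mulVec r s ≤ T * c + v s - (P ^ T).mulVec v s := by
  induction T with
  | zero => simp
  | succ T ih =>
    have hT : P ^ T ∈ Matrix.rowStochastic ℝ S := pow_mem hP T
    have hstep := mulVec_le_mulVec_of_mem_rowStochastic hT (f := r + P.mulVec v)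
      (g := v + fun _ => c) h s
    rw [Matrix.mulVec_add, Matrix.mulVec_add, Matrix.mulVec_mulVec, ← pow_succ, Pi.add_apply,
      Pi.add_apply, mulVec_const_of_mem_rowStochastic hT] at hstep
    rw [Finset.sum_range_succ, Matrix.add_mulVec, Pi.add_apply]
    push_cast
    linarith

/-- If `r + P v ≤ v + c`, then the Cesàro average reward is at most `c`. -/
theorem cesaro_mulVec_le {S : Type*} [Fintype S] [DecidableEq S]
    {P Q : Matrix S S ℝ} (hP : P ∈ Matrix.rowStochastic ℝ S)
    (hQ : ∀ s s', Filter.Tendsto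
      (fun T : ℕ => (∑ t ∈ Finset.range T, P ^ t) s s' / (T : ℝ)) Filter.atTop (nhds (Q s s')))
    {r v : S → ℝ} {c : ℝ} (h : ∀ s, r s + P.mulVec v s ≤ v s + c) (s : S) :
    Q.mulVec r s ≤ c := by
  obtain ⟨b, hb⟩ := (Set.finite_range v).bddBelow
  have hlim : Filter.Tendsto (fun T : ℕ => (∑ t ∈ Finset.range T, P ^ t).mulVec r s / (T : ℝ))
      Filter.atTop (nhds (Q.mulVec r s)) := by
    simp only [Matrix.mulVec, dotProduct, Finset.sum_div, mul_div_right_comm]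
    exact tendsto_finsetSum _ fun s' _ => (hQ s s').mul_const (r s')
  have hbound : Filter.Tendsto (fun T : ℕ => c + (v s - b) / (T : ℝ)) Filter.atTop (nhds c) := by
    simpa using (tendsto_const_div_atTop_nhds_zero_nat (v s - b)).const_add c
  refine le_of_tendsto_of_tendsto hlim hbound ?_
  filter_upwards [Filter.eventually_gt_atTop 0] with T hT
  have hT' : (0 : ℝ) < T := Nat.cast_pos.mpr hT
  have hPT : P ^ T ∈ Matrix.rowStochastic ℝ S := pow_mem hP T
  have hlow := mulVec_le_mulVec_of_mem_rowStochastic hPT (f := fun _ => b) (g := v)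
    (fun x => hb ⟨x, rfl⟩) s
  rw [mulVec_const_of_mem_rowStochastic hPT] at hlow
  have hsum := sum_pow_mulVec_le hP h T s
  rw [div_le_iff₀ hT', add_mul, div_mul_cancel₀ _ hT'.ne']
  linarith

/-- If `v + c ≤ r + P v`, then the Cesàro average reward is at least `c`. -/
theorem le_cesaro_mulVec {S : Type*} [Fintype S] [DecidableEq S]
    {P Q : Matrix S S ℝ} (hP : P ∈ Matrix.rowStochastic ℝ S)
    (hQ : ∀ s s', Filter.Tendsto
      (fun T : ℕ => (∑ t ∈ Finset.range T, P ^ t) s s' / (T : ℝ)) Filter.atTop (nhds (Q s s')))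
    {r v : S → ℝ} {c : ℝ} (h : ∀ s, v s + c ≤ r s + P.mulVec v s) (s : S) :
    c ≤ Q.mulVec r s := by
  have := cesaro_mulVec_le hP hQ (r := -r) (v := -v) (c := -c)
    (fun s => by simp only [Matrix.mulVec_neg, Pi.neg_apply]; linarith [h s]) s
  rw [Matrix.mulVec_neg, Pi.neg_apply] at this
  linarith

/-- Value iteration and its stopping criterion: if `span(u_{n+1} − u_n) ≤ ε` and `π'`
attains the maximum defining `u_{n+1}`, then the gain of `π'` is `ε`-optimal and
`u_{n+1} − u_n` approximates both the optimal gain and the gain of `π'` within `ε`. -/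
theorem value_iteration_stopping {S A : Type*}
    [Fintype S] [Fintype A] [Nonempty S] [Nonempty A] [DecidableEq S]
    (μ : S → A → ℝ) (p : S → A → S → ℝ)
    (hp : ∀ s a, (∀ s', 0 ≤ p s a s') ∧ ∑ s', p s a s' = 1)
    (u : ℕ → S → ℝ)
    (hu0 : ∀ s, u 0 s = 0)
    (hu : ∀ n s, u (n + 1) s =
      Finset.univ.sup' Finset.univ_nonempty (fun a => μ s a + ∑ s', p s a s' * u n s'))
    (Pbar : (S → A) → Matrix S S ℝ)
    (hPbar : ∀ (π : S → A) (s s' : S),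
      Filter.Tendsto
        (fun T : ℕ =>
          (∑ t ∈ Finset.range T, (Matrix.of fun s₁ s₂ => p s₁ (π s₁) s₂) ^ t) s s' / (T : ℝ))
        Filter.atTop (nhds (Pbar π s s')))
    (γ : (S → A) → ℝ)
    (hγ : ∀ (π : S → A) (s : S), (Pbar π).mulVec (fun s₁ => μ s₁ (π s₁)) s = γ π)
    (γstar : ℝ)
    (hγstar : γstar = Finset.univ.sup' Finset.univ_nonempty γ)
    (n : ℕ) (ε : ℝ) (hε : 0 ≤ ε)
    (π' : S → A)
    (hπ' : ∀ s, u (n + 1) s = μ s (π' s) + ∑ s', p s (π' s) s' * u n s')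
    (hspan : distSpan (fun s => u (n + 1) s - u n s) ≤ ε) :
    γstar - γ π' ≤ ε ∧
      (∀ s, |u (n + 1) s - u n s - γstar| ≤ ε) ∧
      (∀ s, |u (n + 1) s - u n s - γ π'| ≤ ε) := by
  set d : S → ℝ := fun s => u (n + 1) s - u n s with hd
  have hM : ∀ s, d s ≤ univ.sup' univ_nonempty d := fun s => Finset.le_sup' d (mem_univ s)
  have hm : ∀ s, univ.inf' univ_nonempty d ≤ d s := fun s => Finset.inf'_le d (mem_univ s)
  rw [distSpan] at hspan
  set M := univ.sup' univ_nonempty d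
  set m := univ.inf' univ_nonempty d
  have hP : ∀ π : S → A,
      (Matrix.of fun s₁ s₂ => p s₁ (π s₁) s₂) ∈ Matrix.rowStochastic ℝ S := fun π =>
    Matrix.mem_rowStochastic_iff_sum.mpr ⟨fun s => (hp s (π s)).1, fun s => (hp s (π s)).2⟩
  have s₀ : S := Classical.arbitrary S
  have hupper : ∀ π, γ π ≤ M := fun π => by
    rw [← hγ π s₀]
    refine cesaro_mulVec_le (hP π) (hPbar π) (v := u n) (fun s => ?_) s₀
    have hmax : μ s (π s) + ∑ s', p s (π s) s' * u n s' ≤ u (n + 1) s := by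
      rw [hu n s]
      exact Finset.le_sup' (fun a => μ s a + ∑ s', p s a s' * u n s') (mem_univ (π s))
    have hMs := hM s
    simp only [hd, Matrix.mulVec, dotProduct, Matrix.of_apply] at hMs ⊢
    linarith
  have hlower : m ≤ γ π' := by
    rw [← hγ π' s₀]
    refine le_cesaro_mulVec (hP π') (hPbar π') (v := u n) (fun s => ?_) s₀
    have hms := hm s
    have hs := hπ' s
    simp only [hd, Matrix.mulVec, dotProduct, Matrix.of_apply] at hms ⊢
    linarith
  have hstar : γstar ≤ M := hγstar ▸ Finset.sup'_le _ _ fun π _ => hupper π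
  have hle : γ π' ≤ γstar := hγstar ▸ Finset.le_sup' γ (mem_univ π')
  have hπ'M := hupper π'
  refine ⟨by linarith, fun s => ?_, fun s => ?_⟩ <;>
  · have hMs : u (n + 1) s - u n s ≤ M := hM s
    have hms : m ≤ u (n + 1) s - u n s := hm s
    rw [abs_le]
    constructor <;> linarith
end
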